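/- Let d ≥ 1, T > 0, and let G : P_2(ℝ^d) → ℝ be bounded from below and continuous with respect to d_2. Fix t ∈ [0,T) and m ∈ P_2(ℝ^d), and let (x^N)_{N≥1} with x^N ∈ (ℝ^d)^N satisfy d_2(m^N_{x^N}, m) → 0 as N → ∞. Then limsup_{N→∞} V^N(t, x^N) ≤ U(t, m). -/

import Mathlib

open MeasureTheory Filter
open scoped ENNReal NNReal BigOperators

noncomputable section

/-- `Ed d` is the Euclidean space `ℝ^d`. -/
abbrev Ed (d : ℕ) := EuclideanSpace ℝ (Fin d)

/-- A Borel probability measure on `ℝ^d` with finite second moment,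
i.e. an element of `P_2(ℝ^d)`. -/
def IsP2 {d : ℕ} (μ : Measure (Ed d)) : Prop :=
  IsProbabilityMeasure μ ∧ Integrable (fun x => ‖x‖ ^ 2) μ

/-- The empirical measure `m_x^N = (1/N) ∑ δ_{x^i}`. -/
def empMeas {d N : ℕ} (x : Fin N → Ed d) : Measure (Ed d) :=
  (N : ℝ≥0∞)⁻¹ • ∑ i, Measure.dirac (x i)

/-- `π` is a coupling of `μ` and `ν`. -/
def IsCoupling {d : ℕ} (π : Measure (Ed d × Ed d)) (μ ν : Measure (Ed d)) : Prop :=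
  IsProbabilityMeasure π ∧ π.map Prod.fst = μ ∧ π.map Prod.snd = ν

/-- The squared 2-Wasserstein distance `d_2(μ,ν)²`, as the infimum over couplings of
`∫ |x - y|² dπ(x,y)` (with value in `[0,∞]`). -/
def d2sq {d : ℕ} (μ ν : Measure (Ed d)) : ℝ≥0∞ :=
  ⨅ (π : Measure (Ed d × Ed d)) (_ : IsCoupling π μ ν),
    ∫⁻ p, (‖p.1 - p.2‖₊ : ℝ≥0∞) ^ 2 ∂π

/-- The 2-Wasserstein distance `d_2(μ,ν)`. -/
def d2 {d : ℕ} (μ ν : Measure (Ed d)) : ℝ := Real.sqrt (d2sq μ ν).toReal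

/-- The 1-Wasserstein distance, via Kantorovich duality:
`d_1(μ,ν) = sup { ∫ f dμ - ∫ f dν : f 1-Lipschitz }`. -/
def d1 {d : ℕ} (μ ν : Measure (Ed d)) : ℝ :=
  sSup { r | ∃ f : Ed d → ℝ, LipschitzWith 1 f ∧ r = (∫ x, f x ∂μ) - ∫ x, f x ∂ν }

/-- The Hopf–Lax mean-field value function
`U(t,m) = inf_{ν ∈ P_2} { G(ν) + d_2(m,ν)²/(2(T-t)) }`. -/
def MFval {d : ℕ} (T : ℝ) (G : Measure (Ed d) → ℝ) (t : ℝ) (m : Measure (Ed d)) : ℝ :=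
  sInf { r | ∃ ν : Measure (Ed d), IsP2 ν ∧
    r = G ν + (d2sq m ν).toReal / (2 * (T - t)) }

/-- The Hopf–Lax `N`-particle value function
`V^N(t,x) = inf_y { G(m_y^N) + (1/(2(T-t)N)) ∑ |x^i - y^i|² }`. -/
def NPval {d N : ℕ} (T : ℝ) (G : Measure (Ed d) → ℝ) (t : ℝ) (x : Fin N → Ed d) : ℝ :=
  sInf { r | ∃ y : Fin N → Ed d,
    r = G (empMeas y) + (1 / (2 * (T - t) * (N : ℝ))) * ∑ i, ‖x i - y i‖ ^ 2 }

open ProbabilityTheory in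
/-- Gluing of two couplings along their common marginal. -/
lemma exists_gluing {d : ℕ} {μ₁ μ₂ μ₃ : Measure (Ed d)}
    {π ρ : Measure (Ed d × Ed d)} (hπ : IsCoupling π μ₁ μ₂) (hρ : IsCoupling ρ μ₂ μ₃) :
    ∃ γ : Measure ((Ed d × Ed d) × Ed d), IsProbabilityMeasure γ ∧
      γ.map Prod.fst = π ∧ γ.map (fun p => (p.1.2, p.2)) = ρ := by
  obtain ⟨hπp, -, hπ2⟩ := hπ
  obtain ⟨hρp, hρ1, -⟩ := hρ
  refine ⟨π ⊗ₘ (ρ.condKernel.prodMkLeft (Ed d)), inferInstance, Measure.fst_compProd _ _, ?_⟩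
  refine Measure.ext_of_lintegral _ fun f hf => ?_
  have hρf : ρ.fst = π.map Prod.snd := by rw [hπ2, ← hρ1, Measure.fst]
  have hg : Measurable fun b => ∫⁻ z, f (b, z) ∂ρ.condKernel b := hf.lintegral_kernel_prod_right'
  rw [lintegral_map hf (by fun_prop), Measure.lintegral_compProd (by fun_prop)]
  conv_rhs => rw [← ρ.disintegrate ρ.condKernel, Measure.lintegral_compProd hf, hρf,
    lintegral_map hg measurable_snd]
  simp

lemma d2sq_le_lintegral {d : ℕ} {μ ν : Measure (Ed d)} {π : Measure (Ed d × Ed d)}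
    (hπ : IsCoupling π μ ν) : d2sq μ ν ≤ ∫⁻ p, (‖p.1 - p.2‖₊ : ℝ≥0∞) ^ 2 ∂π :=
  iInf₂_le π hπ

lemma d2sq_rpow_le_add {d : ℕ} (μ₁ μ₂ μ₃ : Measure (Ed d)) :
    d2sq μ₁ μ₃ ^ (1 / 2 : ℝ) ≤ d2sq μ₁ μ₂ ^ (1 / 2 : ℝ) + d2sq μ₂ μ₃ ^ (1 / 2 : ℝ) := by
  have key : ∀ π ρ : Measure (Ed d × Ed d), IsCoupling π μ₁ μ₂ → IsCoupling ρ μ₂ μ₃ →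
      d2sq μ₁ μ₃ ^ (1 / 2 : ℝ) ≤ (∫⁻ p, (‖p.1 - p.2‖₊ : ℝ≥0∞) ^ 2 ∂π) ^ (1 / 2 : ℝ) +
        (∫⁻ p, (‖p.1 - p.2‖₊ : ℝ≥0∞) ^ 2 ∂ρ) ^ (1 / 2 : ℝ) := by
    intro π ρ hπ hρ
    obtain ⟨γ, hγ, h1, h2⟩ := exists_gluing hπ hρ
    have hc : IsCoupling (γ.map fun p => (p.1.1, p.2)) μ₁ μ₃ := by
      refine ⟨Measure.isProbabilityMeasure_map (by fun_prop), ?_, ?_⟩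
      · rw [← hπ.2.1, ← h1, Measure.map_map (by fun_prop) (by fun_prop),
          Measure.map_map (by fun_prop) (by fun_prop)]
        rfl
      · rw [← hρ.2.2, ← h2, Measure.map_map (by fun_prop) (by fun_prop),
          Measure.map_map (by fun_prop) (by fun_prop)]
        rfl
    have hle : d2sq μ₁ μ₃ ≤ ∫⁻ p, (‖p.1.1 - p.2‖₊ : ℝ≥0∞) ^ 2 ∂γ := by
      refine (d2sq_le_lintegral hc).trans_eq ?_
      rw [lintegral_map (by fun_prop) (by fun_prop)]
    rw [← h1, ← h2, lintegral_map (by fun_prop) (by fun_prop),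
      lintegral_map (by fun_prop) (by fun_prop)]
    have hM := ENNReal.lintegral_Lp_add_le (μ := γ) (p := 2)
      (f := fun p => (‖p.1.1 - p.1.2‖₊ : ℝ≥0∞)) (g := fun p => (‖p.1.2 - p.2‖₊ : ℝ≥0∞))
      (by fun_prop) (by fun_prop) (by norm_num)
    simp only [ENNReal.rpow_ofNat] at hM
    refine le_trans (ENNReal.rpow_le_rpow (hle.trans (lintegral_mono fun p => ?_)) (by norm_num)) hM
    refine pow_le_pow_left' ?_ 2
    rw [Pi.add_apply, ← ENNReal.coe_add, ENNReal.coe_le_coe, ← sub_add_sub_cancel p.1.1 p.1.2 p.2]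
    exact nnnorm_add_le _ _
  have hrpow : ∀ μ ν : Measure (Ed d), d2sq μ ν ^ (1 / 2 : ℝ) =
      ⨅ (π : Measure (Ed d × Ed d)) (_ : IsCoupling π μ ν),
        (∫⁻ p, (‖p.1 - p.2‖₊ : ℝ≥0∞) ^ 2 ∂π) ^ (1 / 2 : ℝ) := by
    intro μ ν
    have := (ENNReal.orderIsoRpow (1 / 2) (by norm_num)).map_iInf₂
      (fun (π : Measure (Ed d × Ed d)) (_ : IsCoupling π μ ν) =>
        ∫⁻ p, (‖p.1 - p.2‖₊ : ℝ≥0∞) ^ 2 ∂π)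
    simpa only [d2sq, ENNReal.orderIsoRpow_apply] using this
  rw [hrpow μ₁ μ₂, hrpow μ₂ μ₃]
  refine ENNReal.le_iInf₂_add_iInf₂ ?_
  intro π hπ ρ hρ
  exact key π ρ hπ hρ

lemma d2sq_ne_top {d : ℕ} {μ ν : Measure (Ed d)} (hμ : IsP2 μ) (hν : IsP2 ν) :
    d2sq μ ν ≠ ∞ := by
  obtain ⟨_, hμi⟩ := hμ
  obtain ⟨_, hνi⟩ := hν
  have hc : IsCoupling (μ.prod ν) μ ν := ⟨inferInstance, by simp, by simp⟩
  refine ne_top_of_le_ne_top ?_ (d2sq_le_lintegral hc)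
  have hint : Integrable (fun p : Ed d × Ed d => 2 * ‖p.1‖ ^ 2 + 2 * ‖p.2‖ ^ 2) (μ.prod ν) :=
    ((hμi.comp_fst ν).const_mul 2).add ((hνi.comp_snd μ).const_mul 2)
  have hint' : Integrable (fun p : Ed d × Ed d => ‖p.1 - p.2‖ ^ 2) (μ.prod ν) := by
    refine hint.mono' (by fun_prop) (ae_of_all _ fun p => ?_)
    rw [Real.norm_of_nonneg (by positivity)]
    nlinarith [norm_sub_le p.1 p.2, norm_nonneg (p.1 - p.2), sq_nonneg (‖p.1‖ - ‖p.2‖)]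
  have := hint'.2
  simp only [HasFiniteIntegral, enorm_pow, enorm_norm] at this
  exact this.ne

lemma d2_eq_toReal_rpow {d : ℕ} (μ ν : Measure (Ed d)) :
    d2 μ ν = (d2sq μ ν ^ (1 / 2 : ℝ)).toReal := by
  rw [d2, Real.sqrt_eq_rpow, ENNReal.toReal_rpow]

lemma d2_nonneg {d : ℕ} (μ ν : Measure (Ed d)) : 0 ≤ d2 μ ν := Real.sqrt_nonneg _

lemma sq_d2 {d : ℕ} (μ ν : Measure (Ed d)) : d2 μ ν ^ 2 = (d2sq μ ν).toReal :=
  Real.sq_sqrt ENNReal.toReal_nonneg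

lemma d2_triangle {d : ℕ} {μ₁ μ₂ μ₃ : Measure (Ed d)} (h₁ : IsP2 μ₁) (h₂ : IsP2 μ₂)
    (h₃ : IsP2 μ₃) : d2 μ₁ μ₃ ≤ d2 μ₁ μ₂ + d2 μ₂ μ₃ := by
  have h12 := ENNReal.rpow_ne_top_of_nonneg (y := 1 / 2) (by norm_num) (d2sq_ne_top h₁ h₂)
  have h23 := ENNReal.rpow_ne_top_of_nonneg (y := 1 / 2) (by norm_num) (d2sq_ne_top h₂ h₃)
  simp only [d2_eq_toReal_rpow]
  rw [← ENNReal.toReal_add h12 h23]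
  exact ENNReal.toReal_mono (ENNReal.add_ne_top.2 ⟨h12, h23⟩) (d2sq_rpow_le_add _ _ _)

lemma exists_simpleFunc_d2_map_lt {d : ℕ} {ν : Measure (Ed d)} (hν : IsP2 ν) {δ : ℝ}
    (hδ : 0 < δ) : ∃ f : SimpleFunc (Ed d) (Ed d), IsP2 (ν.map f) ∧ d2 ν (ν.map f) < δ := by
  obtain ⟨_, hνi⟩ := hν
  have hid : MemLp (fun x : Ed d => x) 2 ν :=
    (memLp_two_iff_integrable_sq_norm (by fun_prop)).2 hνi
  obtain ⟨f, hf, hfm⟩ := hid.exists_simpleFunc_eLpNorm_sub_lt (by simp)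
    (ε := ENNReal.ofReal δ) (by simpa using hδ)
  refine ⟨f, ⟨Measure.isProbabilityMeasure_map f.measurable.aemeasurable, ?_⟩, ?_⟩
  · rw [integrable_map_measure (by fun_prop) f.measurable.aemeasurable]
    exact (memLp_two_iff_integrable_sq_norm f.measurable.aestronglyMeasurable).1 hfm
  · have hm : Measurable fun x => (x, f x) := measurable_id.prodMk f.measurable
    have hc : IsCoupling (ν.map fun x => (x, f x)) ν (ν.map f) := by
      refine ⟨Measure.isProbabilityMeasure_map hm.aemeasurable, ?_, ?_⟩
      · rw [Measure.map_map measurable_fst hm]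
        exact Measure.map_id
      · rw [Measure.map_map measurable_snd hm]
        rfl
    have hle : d2sq ν (ν.map f) ≤ ∫⁻ x, (‖x - f x‖₊ : ℝ≥0∞) ^ 2 ∂ν := by
      refine (d2sq_le_lintegral hc).trans_eq ?_
      rw [lintegral_map (by fun_prop) hm]
    rw [d2_eq_toReal_rpow]
    refine ENNReal.toReal_lt_of_lt_ofReal
      ((ENNReal.rpow_le_rpow hle (by norm_num)).trans_lt ?_)
    rw [eLpNorm_eq_lintegral_rpow_enorm_toReal (by simp) (by simp)] at hf
    simpa [enorm_eq_nnnorm] using hf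
lemma eq_sum_smul_dirac_of_compl_null {α : Type*} [MeasurableSpace α]
    [MeasurableSingletonClass α] (μ : Measure α) (S : Finset α) (hS : μ (S : Set α)ᶜ = 0) :
    μ = ∑ k ∈ S, μ {k} • Measure.dirac k := by
  have hr : μ.restrict (S : Set α) = μ := Measure.restrict_eq_self_of_ae_mem (by
    rw [ae_iff]; exact hS)
  ext A hA
  have hsum : μ (A ∩ S) = ∑ k ∈ S, μ (A ∩ {k}) := by
    rw [← measure_biUnion_finset]
    · congr 1
      ext y
      simp
    · intro i _ j _ hij
      exact (Set.disjoint_singleton.2 hij).mono Set.inter_subset_right Set.inter_subset_right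
    · intro k _
      exact hA.inter (measurableSet_singleton k)
  rw [← hr, Measure.restrict_apply hA, hsum, Measure.finsetSum_apply, hr]
  refine Finset.sum_congr rfl fun k _ => ?_
  by_cases hk : k ∈ A
  · simp [hk, hA]
  · simp [hk, hA]

lemma d2sq_add_le {d : ℕ} (c α β : Measure (Ed d)) [IsFiniteMeasure α] [IsFiniteMeasure β]
    [IsProbabilityMeasure (c + α)] (hαβ : α Set.univ = β Set.univ) {S : Set (Ed d)}
    (hα : α Sᶜ = 0) (hβ : β Sᶜ = 0) {B : ℝ≥0∞}
    (hB : ∀ k ∈ S, ∀ l ∈ S, (‖k - l‖₊ : ℝ≥0∞) ^ 2 ≤ B) :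
    d2sq (c + α) (c + β) ≤ B * α Set.univ := by
  set r := α Set.univ with hr
  have hrt : r ≠ ∞ := measure_ne_top α _
  have hscale : ∀ τ : Measure (Ed d), τ Set.univ = r → (r⁻¹ * r) • τ = τ := by
    intro τ hτ
    rcases eq_or_ne r 0 with h0 | h0
    · rw [h0, Measure.measure_univ_eq_zero] at hτ
      simp [hτ]
    · rw [ENNReal.inv_mul_cancel h0 hrt, one_smul]
  have hdiag : Measurable fun x : Ed d => (x, x) := by fun_prop
  set π : Measure (Ed d × Ed d) := c.map (fun x => (x, x)) + r⁻¹ • α.prod β with hπ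
  have h1 : π.map Prod.fst = c + α := by
    rw [hπ, Measure.map_add _ _ measurable_fst, Measure.map_map measurable_fst hdiag,
      Measure.map_smul, Measure.map_fst_prod, ← hαβ, smul_smul, hscale α rfl]
    congr 1
    exact Measure.map_id
  have h2 : π.map Prod.snd = c + β := by
    rw [hπ, Measure.map_add _ _ measurable_snd, Measure.map_map measurable_snd hdiag,
      Measure.map_smul, Measure.map_snd_prod, ← hr, smul_smul, hscale β hαβ.symm]
    congr 1
    exact Measure.map_id
  have hπp : IsProbabilityMeasure π := by
    have : IsProbabilityMeasure (π.map Prod.fst) := h1 ▸ inferInstance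
    exact Measure.isProbabilityMeasure_of_map Prod.fst
  refine (d2sq_le_lintegral ⟨hπp, h1, h2⟩).trans ?_
  rw [hπ, lintegral_add_measure, lintegral_map (by fun_prop) hdiag, lintegral_smul_measure]
  have hae : ∀ᵐ p ∂(α.prod β), (‖p.1 - p.2‖₊ : ℝ≥0∞) ^ 2 ≤ B := by
    have ha : ∀ᵐ p ∂(α.prod β), p.1 ∈ S := Measure.quasiMeasurePreserving_fst.ae hα
    have hb : ∀ᵐ p ∂(α.prod β), p.2 ∈ S := Measure.quasiMeasurePreserving_snd.ae hβ
    filter_upwards [ha, hb] with p hp hq using hB _ hp _ hq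
  calc _ = r⁻¹ * ∫⁻ p, (‖p.1 - p.2‖₊ : ℝ≥0∞) ^ 2 ∂(α.prod β) := by simp
    _ ≤ r⁻¹ * ∫⁻ p, B ∂(α.prod β) := by gcongr 1; exact lintegral_mono_ae hae
    _ = (r⁻¹ * r) * (B * r) := by
      rw [lintegral_const, ← Set.univ_prod_univ, Measure.prod_prod, ← hαβ, ← hr]; ring
    _ ≤ 1 * (B * r) := by gcongr; exact ENNReal.inv_mul_le_one r
    _ = B * r := one_mul _

lemma d2sq_le_sum_tsub {d : ℕ} (μ ν : Measure (Ed d)) [IsProbabilityMeasure μ]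
    [IsProbabilityMeasure ν] (S : Finset (Ed d)) (hμ : μ (S : Set (Ed d))ᶜ = 0)
    (hν : ν (S : Set (Ed d))ᶜ = 0) {B : ℝ≥0∞}
    (hB : ∀ k ∈ S, ∀ l ∈ S, (‖k - l‖₊ : ℝ≥0∞) ^ 2 ≤ B) :
    d2sq μ ν ≤ B * ∑ k ∈ S, (μ {k} - ν {k}) := by
  have decomp : ∀ (σ τ : Measure (Ed d)), σ (S : Set (Ed d))ᶜ = 0 →
      ∑ k ∈ S, min (σ {k}) (τ {k}) • Measure.dirac k +
        ∑ k ∈ S, (σ {k} - τ {k}) • Measure.dirac k = σ := by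
    intro σ τ hσ
    conv_rhs => rw [eq_sum_smul_dirac_of_compl_null σ S hσ]
    rw [← Finset.sum_add_distrib]
    refine Finset.sum_congr rfl fun k _ => ?_
    rw [← add_smul, add_comm, tsub_add_min]
  have null : ∀ w : Ed d → ℝ≥0∞,
      (∑ k ∈ S, w k • Measure.dirac k : Measure (Ed d)) (S : Set (Ed d))ᶜ = 0 := by
    intro w
    rw [Measure.finsetSum_apply]
    refine Finset.sum_eq_zero fun k hk => ?_
    simp [hk, S.measurableSet.compl]
  set c : Measure (Ed d) := ∑ k ∈ S, min (μ {k}) (ν {k}) • Measure.dirac k with hc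
  set α : Measure (Ed d) := ∑ k ∈ S, (μ {k} - ν {k}) • Measure.dirac k with hα
  set β : Measure (Ed d) := ∑ k ∈ S, (ν {k} - μ {k}) • Measure.dirac k with hβ
  have h1 : c + α = μ := decomp μ ν hμ
  have h2 : c + β = ν := by
    rw [← decomp ν μ hν, hc]
    simp only [min_comm, hβ]
  have hle : ∀ a b : Measure (Ed d), IsProbabilityMeasure (a + b) →
      IsFiniteMeasure a ∧ IsFiniteMeasure b := by
    intro a b _
    exact ⟨isFiniteMeasure_of_le (a + b) (Measure.le_add_right le_rfl),
      isFiniteMeasure_of_le (a + b) (Measure.le_add_left le_rfl)⟩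
  have hp1 : IsProbabilityMeasure (c + α) := h1 ▸ inferInstance
  have hp2 : IsProbabilityMeasure (c + β) := h2 ▸ inferInstance
  obtain ⟨_, _⟩ := hle c α hp1
  obtain ⟨_, _⟩ := hle c β hp2
  have huniv : α Set.univ = β Set.univ := by
    have e1 : c Set.univ + α Set.univ = 1 := hp1.measure_univ
    have e2 : c Set.univ + β Set.univ = 1 := hp2.measure_univ
    exact (ENNReal.add_right_inj (measure_ne_top c _)).1 (e1.trans e2.symm)
  have := d2sq_add_le c α β huniv (null _) (null _) hB
  rw [h1, h2] at this
  refine this.trans_eq ?_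
  rw [hα, Measure.finsetSum_apply]
  simp

/-- Derandomised rounding: one may select points from the measures `q i` so that the total cost and
the squared deviation of the cell counts are controlled by their means under independent sampling. -/
lemma exists_selection {α : Type*} [MeasurableSpace α] [MeasurableSingletonClass α]
    (S : Finset α) {L : ℝ} (hL : 0 ≤ L) (n : ℕ) (q : Fin n → Measure α)
    [∀ i, IsProbabilityMeasure (q i)] (hS : ∀ i, q i (S : Set α)ᶜ = 0)
    (c : Fin n → α → ℝ) (hc : ∀ i, Integrable (c i) (q i)) :
    ∃ y : Fin n → α, (∀ i, y i ∈ S) ∧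
      ∑ i, c i (y i) + L * ∑ k ∈ S,
        (∑ i, (Set.indicator {k} (1 : α → ℝ) (y i) - (q i).real {k})) ^ 2 ≤
      ∑ i, ∫ z, c i z ∂(q i) + L * n := by
  induction n with
  | zero => exact ⟨Fin.elim0, fun i => i.elim0, by simp⟩
  | succ n ih =>
    obtain ⟨y, hyS, hy⟩ := ih (fun i => q i.castSucc) (fun i => hS _) (fun i => c i.castSucc)
      (fun i => hc _)
    set D : α → ℝ := fun k =>
      ∑ i, (Set.indicator {k} (1 : α → ℝ) (y i) - (q i.castSucc).real {k})
    set ρ := q (Fin.last n)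
    have hsq : ∀ k z, (D k + (Set.indicator {k} (1 : α → ℝ) z - ρ.real {k})) ^ 2 =
        Set.indicator {k} (1 : α → ℝ) z * (1 + 2 * (D k - ρ.real {k})) +
          (D k - ρ.real {k}) ^ 2 := by
      intro k z
      by_cases hz : z ∈ ({k} : Set α)
      · simp only [Set.indicator_of_mem hz, Pi.one_apply]; ring
      · simp only [Set.indicator_of_notMem hz]; ring
    have hind : ∀ k, Integrable (Set.indicator {k} (1 : α → ℝ)) ρ := fun k =>
      (integrable_indicator_iff (measurableSet_singleton k)).2 (integrable_const 1).integrableOn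
    have hint : ∀ k, Integrable
        (fun z => (D k + (Set.indicator {k} (1 : α → ℝ) z - ρ.real {k})) ^ 2) ρ := by
      intro k
      simp only [hsq]
      exact ((hind k).mul_const _).add (integrable_const _)
    have hval : ∀ k, ∫ z, (D k + (Set.indicator {k} (1 : α → ℝ) z - ρ.real {k})) ^ 2 ∂ρ =
        D k ^ 2 + ρ.real {k} - ρ.real {k} ^ 2 := by
      intro k
      simp only [hsq]
      rw [integral_add ((hind k).mul_const _) (integrable_const _), integral_mul_const,
        integral_indicator_one (measurableSet_singleton k), integral_const]
      simp
      ring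
    have hsum : ∑ k ∈ S, ρ.real {k} ≤ 1 := by
      rw [sum_measureReal_singleton]
      exact measureReal_le_one
    have hF : Integrable (fun z => c (Fin.last n) z + L * ∑ k ∈ S,
        (D k + (Set.indicator {k} (1 : α → ℝ) z - ρ.real {k})) ^ 2) ρ :=
      (hc _).add ((integrable_finsetSum _ fun k _ => hint k).const_mul L)
    obtain ⟨z, hzS, hz⟩ := exists_notMem_null_le_integral hF (hS (Fin.last n))
    rw [integral_add (hc _) ((integrable_finsetSum _ fun k _ => hint k).const_mul L),
      integral_const_mul, integral_finsetSum _ (fun k _ => hint k)] at hz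
    simp only [hval] at hz
    have hbound : ∑ k ∈ S, (D k ^ 2 + ρ.real {k} - ρ.real {k} ^ 2) ≤ ∑ k ∈ S, D k ^ 2 + 1 := by
      rw [Finset.sum_sub_distrib, Finset.sum_add_distrib]
      have : 0 ≤ ∑ k ∈ S, ρ.real {k} ^ 2 := Finset.sum_nonneg fun k _ => sq_nonneg _
      linarith
    have hL' := mul_le_mul_of_nonneg_left hbound hL
    refine ⟨Fin.snoc y z, ?_, ?_⟩
    · intro i
      refine Fin.lastCases ?_ (fun j => ?_) i
      · simpa using hzS
      · simpa using hyS j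
    · simp only [Fin.sum_univ_castSucc, Fin.snoc_castSucc, Fin.snoc_last]
      push_cast
      change _ ≤ _ at hy
      linarith

lemma lintegral_empMeas {d N : ℕ} (x : Fin N → Ed d) (f : Ed d → ℝ≥0∞) :
    ∫⁻ z, f z ∂(empMeas x) = (N : ℝ≥0∞)⁻¹ * ∑ i, f (x i) := by
  simp [empMeas, lintegral_smul_measure, lintegral_finsetSum_measure]

lemma isProbabilityMeasure_empMeas {d N : ℕ} (hN : N ≠ 0) (x : Fin N → Ed d) :
    IsProbabilityMeasure (empMeas x) := by
  constructor
  have h := lintegral_empMeas x (fun _ => 1)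
  simp only [lintegral_one] at h
  rw [h]
  simpa using ENNReal.inv_mul_cancel (by exact_mod_cast hN) (by simp)

lemma isP2_empMeas {d N : ℕ} (hN : N ≠ 0) (x : Fin N → Ed d) : IsP2 (empMeas x) := by
  refine ⟨isProbabilityMeasure_empMeas hN x, ?_⟩
  refine Integrable.smul_measure ?_ (by simpa using hN)
  exact integrable_finsetSum_measure.2 fun i _ => integrable_dirac (by simp)

lemma real_empMeas_singleton {d N : ℕ} (x : Fin N → Ed d) (k : Ed d) :
    (empMeas x).real {k} =
      (N : ℝ)⁻¹ * ∑ i, Set.indicator {k} (1 : Ed d → ℝ) (x i) := by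
  have h : empMeas x {k} = (N : ℝ≥0∞)⁻¹ * ∑ i, Set.indicator {k} (1 : Ed d → ℝ≥0∞) (x i) := by
    simp [empMeas, Measure.finsetSum_apply]
  rw [measureReal_def, h, ENNReal.toReal_mul, ENNReal.toReal_inv, ENNReal.toReal_natCast,
    ENNReal.toReal_sum fun i _ => by by_cases hi : x i ∈ ({k} : Set (Ed d)) <;> simp [hi]]
  congr 1
  refine Finset.sum_congr rfl fun i _ => ?_
  by_cases hi : x i ∈ ({k} : Set (Ed d)) <;> simp [hi]

/-- A coupling of an empirical measure with `ν` splits into one conditional law per particle. -/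
lemma IsCoupling.exists_conditional {d N : ℕ} {x : Fin N → Ed d} {ν : Measure (Ed d)}
    {γ : Measure (Ed d × Ed d)} (hγ : IsCoupling γ (empMeas x) ν) :
    ∃ q : Fin N → Measure (Ed d), (∀ i, IsProbabilityMeasure (q i)) ∧
      (∀ A, MeasurableSet A → ν A = (N : ℝ≥0∞)⁻¹ * ∑ i, q i A) ∧
      ∫⁻ p, (‖p.1 - p.2‖₊ : ℝ≥0∞) ^ 2 ∂γ =
        (N : ℝ≥0∞)⁻¹ * ∑ i, ∫⁻ z, (‖x i - z‖₊ : ℝ≥0∞) ^ 2 ∂(q i) := by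
  obtain ⟨hγp, h1, h2⟩ := hγ
  have hdis : ∀ f : Ed d × Ed d → ℝ≥0∞, Measurable f →
      ∫⁻ p, f p ∂γ = (N : ℝ≥0∞)⁻¹ * ∑ i, ∫⁻ z, f (x i, z) ∂(γ.condKernel (x i)) := by
    intro f hf
    conv_lhs => rw [← γ.disintegrate γ.condKernel, Measure.lintegral_compProd hf,
      Measure.fst, h1, lintegral_empMeas]
  refine ⟨fun i => γ.condKernel (x i), fun i => inferInstance, fun A hA => ?_, ?_⟩
  · have h := hdis (fun p => A.indicator 1 p.2) ((measurable_one.indicator hA).comp measurable_snd)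
    simp only [lintegral_indicator_one hA] at h
    rw [← h, ← h2, ← lintegral_indicator_one hA,
      lintegral_map (measurable_one.indicator hA) measurable_snd]
  · exact hdis _ (by fun_prop)

lemma exists_particles_of_finite_support {d N : ℕ} (hN : N ≠ 0) {ν : Measure (Ed d)}
    [IsProbabilityMeasure ν] (S : Finset (Ed d)) (hν : ν (S : Set (Ed d))ᶜ = 0) {C ε : ℝ}
    (hε : 0 < ε) (x : Fin N → Ed d) (hx : d2sq (empMeas x) ν < ENNReal.ofReal C) :
    ∃ y : Fin N → Ed d, (∀ i, y i ∈ S) ∧ (N : ℝ)⁻¹ * ∑ i, ‖x i - y i‖ ^ 2 ≤ C + ε ∧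
      ∀ k ∈ S, |ν.real {k} - (empMeas y).real {k}| ≤ √((C + ε) / (ε * N)) := by
  have hNpos : (0 : ℝ) < N := by positivity
  have hN0 : (N : ℝ≥0∞)⁻¹ ≠ 0 := by simp
  simp only [d2sq, iInf_lt_iff] at hx
  obtain ⟨γ, hγ, hcost⟩ := hx
  obtain ⟨q, hq, hνq, hcq⟩ := hγ.exists_conditional
  rw [hcq] at hcost
  have hC : 0 < C := by
    by_contra h
    rw [ENNReal.ofReal_of_nonpos (not_lt.1 h)] at hcost
    exact not_lt_bot hcost
  have hqS : ∀ i, q i (S : Set (Ed d))ᶜ = 0 := by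
    have h := hνq _ S.measurableSet.compl
    rw [hν, eq_comm, mul_eq_zero, Finset.sum_eq_zero_iff] at h
    exact fun i => h.resolve_left hN0 i (Finset.mem_univ i)
  have hsum_top : ∑ i, ∫⁻ z, (‖x i - z‖₊ : ℝ≥0∞) ^ 2 ∂(q i) ≠ ∞ := by
    intro h
    rw [h, ENNReal.mul_top hN0] at hcost
    exact not_top_lt hcost
  have hi_top : ∀ i, ∫⁻ z, (‖x i - z‖₊ : ℝ≥0∞) ^ 2 ∂(q i) ≠ ∞ := fun i =>
    ENNReal.sum_ne_top.1 hsum_top i (Finset.mem_univ i)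
  have hint : ∀ i, Integrable (fun z => ‖x i - z‖ ^ 2) (q i) := by
    intro i
    refine ⟨by fun_prop, ?_⟩
    simp only [HasFiniteIntegral, enorm_pow, enorm_norm]
    exact (hi_top i).lt_top
  have hintval : ∀ i, ∫ z, ‖x i - z‖ ^ 2 ∂(q i) =
      (∫⁻ z, (‖x i - z‖₊ : ℝ≥0∞) ^ 2 ∂(q i)).toReal := by
    intro i
    rw [integral_eq_lintegral_of_nonneg_ae (ae_of_all _ fun z => by positivity) (hint i).1]
    congr 1
    refine lintegral_congr fun z => ?_
    rw [ENNReal.ofReal_pow (norm_nonneg _), ofReal_norm, enorm_eq_nnnorm]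
  have hmean : ∑ i, ∫ z, ‖x i - z‖ ^ 2 ∂(q i) ≤ C * N := by
    simp only [hintval]
    rw [← ENNReal.toReal_sum fun i _ => hi_top i]
    have h := ENNReal.toReal_mono ENNReal.ofReal_ne_top hcost.le
    rw [ENNReal.toReal_mul, ENNReal.toReal_inv, ENNReal.toReal_natCast,
      ENNReal.toReal_ofReal hC.le, inv_mul_le_iff₀ hNpos] at h
    linarith
  obtain ⟨y, hyS, hy⟩ := exists_selection S hε.le N q hqS (fun i z => ‖x i - z‖ ^ 2) hint
  refine ⟨y, hyS, ?_, ?_⟩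
  · rw [inv_mul_le_iff₀ hNpos]
    have : 0 ≤ ε * ∑ k ∈ S,
        (∑ i, (Set.indicator {k} (1 : Ed d → ℝ) (y i) - (q i).real {k})) ^ 2 :=
      mul_nonneg hε.le (Finset.sum_nonneg fun k _ => sq_nonneg _)
    linarith
  · intro k hk
    have hνk : ν.real {k} = (N : ℝ)⁻¹ * ∑ i, (q i).real {k} := by
      rw [measureReal_def, hνq _ (measurableSet_singleton k), ENNReal.toReal_mul,
        ENNReal.toReal_inv, ENNReal.toReal_natCast,
        ENNReal.toReal_sum fun i _ => measure_ne_top _ _]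
      rfl
    set D := ∑ i, (Set.indicator {k} (1 : Ed d → ℝ) (y i) - (q i).real {k}) with hD
    have hdiff : ν.real {k} - (empMeas y).real {k} = -((N : ℝ)⁻¹ * D) := by
      rw [hνk, real_empMeas_singleton, hD, Finset.sum_sub_distrib]
      ring
    have hDk : D ^ 2 ≤ ∑ k ∈ S,
        (∑ i, (Set.indicator {k} (1 : Ed d → ℝ) (y i) - (q i).real {k})) ^ 2 :=
      Finset.single_le_sum (f := fun k =>
        (∑ i, (Set.indicator {k} (1 : Ed d → ℝ) (y i) - (q i).real {k})) ^ 2)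
        (fun k _ => sq_nonneg _) hk
    have hcnn : 0 ≤ ∑ i, ‖x i - y i‖ ^ 2 := Finset.sum_nonneg fun i _ => by positivity
    have hDb : ε * D ^ 2 ≤ (C + ε) * N := by
      have := mul_le_mul_of_nonneg_left hDk hε.le
      linarith
    rw [hdiff, abs_neg]
    refine Real.abs_le_sqrt ?_
    rw [le_div_iff₀ (by positivity)]
    calc ((N : ℝ)⁻¹ * D) ^ 2 * (ε * N) = (N : ℝ)⁻¹ * (ε * D ^ 2) := by field_simp
      _ ≤ (N : ℝ)⁻¹ * ((C + ε) * N) := by gcongr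
      _ = C + ε := by field_simp

lemma empMeas_compl_eq_zero {d N : ℕ} {y : Fin N → Ed d} {S : Finset (Ed d)}
    (hy : ∀ i, y i ∈ S) : empMeas y (S : Set (Ed d))ᶜ = 0 := by
  simp [empMeas, Measure.finsetSum_apply, hy]

lemma exists_d2_le_sqrt_of_finite_support {d : ℕ} (S : Finset (Ed d)) :
    ∃ K : ℝ, 0 ≤ K ∧ ∀ (μ ν : Measure (Ed d)) [IsProbabilityMeasure μ] [IsProbabilityMeasure ν],
      μ (S : Set (Ed d))ᶜ = 0 → ν (S : Set (Ed d))ᶜ = 0 → ∀ r : ℝ, 0 ≤ r →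
        (∀ k ∈ S, |μ.real {k} - ν.real {k}| ≤ r) → d2 μ ν ≤ √(K * r) := by
  set B : ℝ≥0 := ∑ k ∈ S, ∑ l ∈ S, ‖k - l‖₊ ^ 2
  have hB : ∀ k ∈ S, ∀ l ∈ S, (‖k - l‖₊ : ℝ≥0∞) ^ 2 ≤ B := by
    intro k hk l hl
    rw [← ENNReal.coe_pow, ENNReal.coe_le_coe]
    calc ‖k - l‖₊ ^ 2 ≤ ∑ l ∈ S, ‖k - l‖₊ ^ 2 :=
          Finset.single_le_sum (f := fun l => ‖k - l‖₊ ^ 2) (fun _ _ => zero_le) hl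
      _ ≤ B := Finset.single_le_sum (f := fun k => ∑ l ∈ S, ‖k - l‖₊ ^ 2)
          (fun _ _ => zero_le) hk
  refine ⟨B * S.card, by positivity, fun μ ν _ _ hμ hν r hr h => ?_⟩
  have hle : d2sq μ ν ≤ ENNReal.ofReal (B * S.card * r) := by
    refine (d2sq_le_sum_tsub μ ν S hμ hν hB).trans ?_
    have hk : ∀ k ∈ S, μ {k} - ν {k} ≤ ENNReal.ofReal r := by
      intro k hk
      rw [← ofReal_measureReal (μ := μ), ← ofReal_measureReal (μ := ν),
        ← ENNReal.ofReal_sub _ measureReal_nonneg]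
      exact ENNReal.ofReal_le_ofReal ((le_abs_self _).trans (h k hk))
    calc _ ≤ (B : ℝ≥0∞) * (S.card • ENNReal.ofReal r) := by
          gcongr
          exact Finset.sum_le_card_nsmul _ _ _ hk
      _ = _ := by
          rw [ENNReal.ofReal_mul (by positivity), ENNReal.ofReal_mul (by positivity),
            ENNReal.ofReal_coe_nnreal, ENNReal.ofReal_natCast, nsmul_eq_mul, mul_assoc]
  exact Real.sqrt_le_sqrt (ENNReal.toReal_le_of_le_ofReal (by positivity) hle)

lemma eventually_exists_particles {d : ℕ} {ν : Measure (Ed d)} [IsProbabilityMeasure ν]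
    (S : Finset (Ed d)) (hν : ν (S : Set (Ed d))ᶜ = 0) {C ε δ : ℝ} (hε : 0 < ε) (hδ : 0 < δ) :
    ∀ᶠ N : ℕ in atTop, ∀ x : Fin N → Ed d, d2sq (empMeas x) ν < ENNReal.ofReal C →
      ∃ y : Fin N → Ed d, (N : ℝ)⁻¹ * ∑ i, ‖x i - y i‖ ^ 2 ≤ C + ε ∧ d2 ν (empMeas y) < δ := by
  obtain ⟨K, hK, hd2⟩ := exists_d2_le_sqrt_of_finite_support S
  have hlim : Tendsto (fun N : ℕ => √(K * √((C + ε) / (ε * N)))) atTop (nhds 0) := by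
    have h : Tendsto (fun N : ℕ => (C + ε) / (ε * N)) atTop (nhds 0) :=
      tendsto_const_nhds.div_atTop (tendsto_natCast_atTop_atTop.const_mul_atTop hε)
    simpa using ((h.sqrt).const_mul K).sqrt
  filter_upwards [hlim.eventually_lt_const hδ, eventually_ne_atTop 0] with N hNδ hN x hx
  obtain ⟨y, hyS, hcost, hdev⟩ := exists_particles_of_finite_support hN S hν hε x hx
  have := isProbabilityMeasure_empMeas hN y
  exact ⟨y, hcost, (hd2 ν (empMeas y) hν (empMeas_compl_eq_zero hyS) _ (Real.sqrt_nonneg _)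
    hdev).trans_lt hNδ⟩

lemma mem_lowerBounds_NPval {d N : ℕ} (hN : N ≠ 0) {T t c : ℝ} (htT : t < T)
    {G : Measure (Ed d) → ℝ} (hc : ∀ μ : Measure (Ed d), IsP2 μ → c ≤ G μ) (x : Fin N → Ed d) :
    c ∈ lowerBounds { r | ∃ y : Fin N → Ed d,
      r = G (empMeas y) + (1 / (2 * (T - t) * (N : ℝ))) * ∑ i, ‖x i - y i‖ ^ 2 } := by
  rintro r ⟨y, rfl⟩
  have h1 := hc _ (isP2_empMeas hN y)
  have h2 : 0 < T - t := sub_pos.2 htT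
  have h3 : 0 ≤ (1 / (2 * (T - t) * (N : ℝ))) * ∑ i, ‖x i - y i‖ ^ 2 := by positivity
  linarith

lemma eventually_NPval_le {d : ℕ} {T t c : ℝ} (htT : t < T) {G : Measure (Ed d) → ℝ}
    (hc : ∀ μ : Measure (Ed d), IsP2 μ → c ≤ G μ)
    (hGcont : ∀ μ : Measure (Ed d), IsP2 μ → ∀ ε : ℝ, 0 < ε → ∃ δ : ℝ, 0 < δ ∧
      ∀ ν : Measure (Ed d), IsP2 ν → d2 μ ν < δ → |G ν - G μ| < ε)
    {m ν : Measure (Ed d)} (hm : IsP2 m) (hν : IsP2 ν) {x : ∀ N : ℕ, Fin N → Ed d}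
    (hx : Tendsto (fun N : ℕ => d2 (empMeas (x N)) m) atTop (nhds 0)) {η : ℝ} (hη : 0 < η) :
    ∀ᶠ N : ℕ in atTop, NPval T G t (x N) ≤
      G ν + 2 * η + (1 / (2 * (T - t))) * ((d2 m ν + 3 * η) ^ 2 + η) := by
  obtain ⟨δ, hδ, hGδ⟩ := hGcont ν hν η hη
  obtain ⟨f, hfP2, hf⟩ := exists_simpleFunc_d2_map_lt hν (lt_min hδ hη)
  have hfp := hfP2.1
  obtain ⟨δ', hδ', hGδ'⟩ := hGcont _ hfP2 η hη
  have hfS : ν.map f (f.range : Set (Ed d))ᶜ = 0 := by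
    rw [Measure.map_apply f.measurable f.range.measurableSet.compl]
    convert measure_empty (μ := ν)
    ext z
    simp
  have hTt : 0 < T - t := sub_pos.2 htT
  filter_upwards [hx.eventually_lt_const hη, eventually_ne_atTop 0,
    eventually_exists_particles f.range hfS (C := (d2 m ν + 3 * η) ^ 2) hη hδ']
    with N hxN hN hpart
  have hxP2 := isP2_empMeas hN (x N)
  have hd : d2 (empMeas (x N)) (ν.map f) < d2 m ν + 3 * η := by
    have h1 := d2_triangle hxP2 hm hfP2
    have h2 := d2_triangle hm hν hfP2
    have h3 := hf.trans_le (min_le_right _ _)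
    linarith
  obtain ⟨y, hcost, hyd⟩ := hpart (x N) (by
    rw [ENNReal.lt_ofReal_iff_toReal_lt (d2sq_ne_top hxP2 hfP2), ← sq_d2]
    exact pow_lt_pow_left₀ hd (d2_nonneg _ _) two_ne_zero)
  have hG1 := (abs_lt.1 (hGδ _ hfP2 (hf.trans_le (min_le_left _ _)))).2
  have hG2 := (abs_lt.1 (hGδ' _ (isP2_empMeas hN y) hyd)).2
  refine (csInf_le ⟨c, mem_lowerBounds_NPval hN htT hc (x N)⟩ ⟨y, rfl⟩).trans ?_
  have hcost' : (1 / (2 * (T - t) * (N : ℝ))) * ∑ i, ‖x N i - y i‖ ^ 2 ≤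
      (1 / (2 * (T - t))) * ((d2 m ν + 3 * η) ^ 2 + η) := by
    calc _ = (1 / (2 * (T - t))) * ((N : ℝ)⁻¹ * ∑ i, ‖x N i - y i‖ ^ 2) := by
          rw [← mul_assoc, one_div, one_div, mul_inv _ (N : ℝ)]
      _ ≤ _ := by gcongr
  linarith

/-- if `G` is bounded below and `d_2`-continuous, and the empirical measures
of `x^N` converge to `m` in `d_2`, then `limsup_N V^N(t, x^N) ≤ U(t, m)`. -/
theorem limsup_nParticleVal_le {d : ℕ} (hd : 1 ≤ d)
    (T : ℝ) (hT : 0 < T)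
    (G : Measure (Ed d) → ℝ)
    (hGbd : ∃ c : ℝ, ∀ μ : Measure (Ed d), IsP2 μ → c ≤ G μ)
    (hGcont : ∀ μ : Measure (Ed d), IsP2 μ → ∀ ε : ℝ, 0 < ε → ∃ δ : ℝ, 0 < δ ∧
      ∀ ν : Measure (Ed d), IsP2 ν → d2 μ ν < δ → |G ν - G μ| < ε)
    (t : ℝ) (ht : 0 ≤ t) (htT : t < T)
    (m : Measure (Ed d)) (hm : IsP2 m)
    (x : ∀ N : ℕ, Fin N → Ed d)
    (hx : Tendsto (fun N : ℕ => d2 (empMeas (x N)) m) atTop (nhds 0)) :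
    limsup (fun N : ℕ => NPval T G t (x N)) atTop ≤ MFval T G t m := by
  obtain ⟨c, hc⟩ := hGbd
  have hlower : ∀ᶠ N : ℕ in atTop, c ≤ NPval T G t (x N) := by
    filter_upwards [eventually_ne_atTop 0] with N hN
    exact le_csInf ⟨_, x N, rfl⟩ (mem_lowerBounds_NPval hN htT hc (x N))
  have hcob : IsCoboundedUnder (· ≤ ·) atTop (fun N : ℕ => NPval T G t (x N)) :=
    (isBoundedUnder_of_eventually_ge hlower).isCoboundedUnder_le
  refine le_csInf ⟨_, m, hm, rfl⟩ ?_
  rintro _ ⟨ν, hν, rfl⟩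
  have hlim : Tendsto (fun η : ℝ => G ν + 2 * η +
      (1 / (2 * (T - t))) * ((d2 m ν + 3 * η) ^ 2 + η)) (nhdsWithin 0 (Set.Ioi 0))
      (nhds (G ν + (d2sq m ν).toReal / (2 * (T - t)))) := by
    refine Tendsto.mono_left ?_ nhdsWithin_le_nhds
    have hcont : Continuous (fun η : ℝ => G ν + 2 * η +
      (1 / (2 * (T - t))) * ((d2 m ν + 3 * η) ^ 2 + η)) := by fun_prop
    convert hcont.tendsto 0 using 2
    rw [← sq_d2]
    ring
  refine ge_of_tendsto hlim ?_
  filter_upwards [self_mem_nhdsWithin] with η hη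
  exact limsup_le_of_le hcob (eventually_NPval_le htT hc hGcont hm hν hx hη)

end
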